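/- Let A be an A∞-algebra over a commutative ring R, let M and N be A∞-bimodules over A, and let f = (f_{r,s})_{r,s≥0} : M → N be a morphism of A∞-bimodules of degree d. Then the induced map f_* : CH_*(A;M) → CH_*(A;N) is a chain map of degree −d, i.e. f_*(CH_j(A;M)) ⊂ CH_{j−d}(A;N) for all j and b ∘ f_* = f_* ∘ b. -/

import Mathlib

namespace AInfPaper

open Finset
open scoped TensorProduct

attribute [local instance 2000] AddCommGroup.toAddCommMonoid

/-- The sign `(-1)^k` for `k : ℤ`. -/
def sgn (k : ℤ) : ℤ := (-1) ^ k.natAbs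

section

variable (R : Type) [CommRing R]

/-- `R`-multilinearity of an `n`-ary map between modules. -/
def IsMultilinear {A B : Type} [AddCommGroup A] [Module R A] [AddCommGroup B] [Module R B]
    {n : ℕ} (g : (Fin n → A) → B) : Prop :=
  (∀ (v : Fin n → A) (i : Fin n) (x y : A),
      g (Function.update v i (x + y)) = g (Function.update v i x) + g (Function.update v i y)) ∧
  (∀ (v : Fin n → A) (i : Fin n) (c : R) (x : A),
      g (Function.update v i (c • x)) = c • g (Function.update v i x))

/-- `R`-linearity in every slot of a map `A^{⊗r} ⊗ M ⊗ A^{⊗s} → N`. -/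
def IsTriMultilinear {A M N : Type} [AddCommGroup A] [Module R A] [AddCommGroup M] [Module R M]
    [AddCommGroup N] [Module R N] {r s : ℕ}
    (g : (Fin r → A) → M → (Fin s → A) → N) : Prop :=
  (∀ (x : Fin r → A) (m : M) (y : Fin s → A) (i : Fin r) (v w : A),
      g (Function.update x i (v + w)) m y
        = g (Function.update x i v) m y + g (Function.update x i w) m y) ∧
  (∀ (x : Fin r → A) (m : M) (y : Fin s → A) (i : Fin r) (c : R) (v : A),
      g (Function.update x i (c • v)) m y = c • g (Function.update x i v) m y) ∧
  (∀ (x : Fin r → A) (m₁ m₂ : M) (y : Fin s → A), g x (m₁ + m₂) y = g x m₁ y + g x m₂ y) ∧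
  (∀ (x : Fin r → A) (c : R) (m : M) (y : Fin s → A), g x (c • m) y = c • g x m y) ∧
  (∀ (x : Fin r → A) (m : M) (y : Fin s → A) (j : Fin s) (v w : A),
      g x m (Function.update y j (v + w))
        = g x m (Function.update y j v) + g x m (Function.update y j w)) ∧
  (∀ (x : Fin r → A) (m : M) (y : Fin s → A) (j : Fin s) (c : R) (v : A),
      g x m (Function.update y j (c • v)) = c • g x m (Function.update y j v))

/-- The conditions making `(gr, μ)` an `A∞`-algebra structure on `A`:
multilinearity of the operations, gradedness (`deg μₙ = 2 − n`) and the `A∞`-equations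
(on homogeneous elements, with the Koszul signs `(-1)^{✠₁^{i-1}}` computed from
the reduced degrees `‖a‖ = deg a − 1`). -/
def IsAInftyAlgebra {A : Type} [AddCommGroup A] [Module R A]
    (gr : ℤ → Submodule R A) (μ : (n : ℕ) → (Fin n → A) → A) : Prop :=
  (∀ n : ℕ, IsMultilinear R (μ n)) ∧
  (∀ (n : ℕ) (d : Fin n → ℤ) (a : Fin n → A),
      (∀ i, a i ∈ gr (d i)) → μ n a ∈ gr ((∑ i, d i) + 2 - n)) ∧
  (∀ (r : ℕ), 1 ≤ r → ∀ (d : ℕ → ℤ) (a : ℕ → A), (∀ q, q < r → a q ∈ gr (d q)) →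
    ∑ n₁ ∈ Finset.Icc 1 r, ∑ i ∈ Finset.range (r + 1 - n₁),
      sgn (∑ q ∈ Finset.range i, (d q - 1)) •
        μ (r + 1 - n₁) (fun j =>
          if (j : ℕ) < i then a (j : ℕ)
          else if (j : ℕ) = i then μ n₁ (fun k => a (i + (k : ℕ)))
          else a ((j : ℕ) + n₁ - 1)) = 0)

/-- The conditions making `(grM, μM)` an `A∞`-bimodule over the `A∞`-algebra `(gr, μ)`:
multilinearity, gradedness (`deg μM_{r,s} = 1 − r − s`) and the defining equations of
type `(r,s)` evaluated on homogeneous elements `a_1, …, a_{r+s}` (stored as `a 0, …,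
a (r+s-1)` of degrees `d 0, …`) and `m` of degree `dm`. -/
def IsAInftyBimodule {A M : Type} [AddCommGroup A] [Module R A] [AddCommGroup M] [Module R M]
    (gr : ℤ → Submodule R A) (μ : (n : ℕ) → (Fin n → A) → A)
    (grM : ℤ → Submodule R M)
    (μM : (r s : ℕ) → (Fin r → A) → M → (Fin s → A) → M) : Prop :=
  (∀ r s : ℕ, IsTriMultilinear R (μM r s)) ∧
  (∀ (r s : ℕ) (dx : Fin r → ℤ) (dm : ℤ) (dy : Fin s → ℤ)
      (x : Fin r → A) (m : M) (y : Fin s → A),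
      (∀ i, x i ∈ gr (dx i)) → m ∈ grM dm → (∀ j, y j ∈ gr (dy j)) →
      μM r s x m y ∈ grM ((∑ i, dx i) + dm + (∑ j, dy j) + 1 - r - s)) ∧
  (∀ (r s : ℕ) (d : ℕ → ℤ) (dm : ℤ) (a : ℕ → A) (m : M),
      (∀ q, q < r + s → a q ∈ gr (d q)) → m ∈ grM dm →
      (∑ r₂ ∈ Finset.Icc 1 r, ∑ i ∈ Finset.range (r + 1 - r₂),
          sgn (∑ q ∈ Finset.range i, (d q - 1)) •
            μM (r + 1 - r₂) s
              (fun j => if (j : ℕ) < i then a (j : ℕ)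
                else if (j : ℕ) = i then μ r₂ (fun k => a (i + (k : ℕ)))
                else a ((j : ℕ) + r₂ - 1))
              m (fun j => a (r + (j : ℕ))))
      + (∑ r₁ ∈ Finset.range (r + 1), ∑ s₁ ∈ Finset.range (s + 1),
          sgn (∑ q ∈ Finset.range r₁, (d q - 1)) •
            μM r₁ s₁ (fun j => a (j : ℕ))
              (μM (r - r₁) (s - s₁) (fun j => a (r₁ + (j : ℕ))) m (fun j => a (r + (j : ℕ))))
              (fun j => a (r + (s - s₁) + (j : ℕ))))
      + (∑ s₂ ∈ Finset.Icc 1 s, ∑ i ∈ Finset.range (s + 1 - s₂),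
          sgn ((∑ q ∈ Finset.range (r + i), (d q - 1)) + dm) •
            μM r (s + 1 - s₂) (fun k => a (k : ℕ)) m
              (fun k => if (k : ℕ) < i then a (r + (k : ℕ))
                else if (k : ℕ) = i then μ s₂ (fun t => a (r + i + (t : ℕ)))
                else a (r + (k : ℕ) + s₂ - 1))) = 0)

/-- The conditions making a family `f = (f_{r,s})` a morphism of `A∞`-bimodules
`M → N` over `(gr, μ)` of degree `dg`. -/
def IsBimoduleMorphism {A M N : Type} [AddCommGroup A] [Module R A] [AddCommGroup M] [Module R M]
    [AddCommGroup N] [Module R N]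
    (gr : ℤ → Submodule R A) (μ : (n : ℕ) → (Fin n → A) → A)
    (grM : ℤ → Submodule R M) (μM : (r s : ℕ) → (Fin r → A) → M → (Fin s → A) → M)
    (grN : ℤ → Submodule R N) (μN : (r s : ℕ) → (Fin r → A) → N → (Fin s → A) → N)
    (dg : ℤ)
    (f : (r s : ℕ) → (Fin r → A) → M → (Fin s → A) → N) : Prop :=
  (∀ r s : ℕ, IsTriMultilinear R (f r s)) ∧
  (∀ (r s : ℕ) (dx : Fin r → ℤ) (dm : ℤ) (dy : Fin s → ℤ)
      (x : Fin r → A) (m : M) (y : Fin s → A),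
      (∀ i, x i ∈ gr (dx i)) → m ∈ grM dm → (∀ j, y j ∈ gr (dy j)) →
      f r s x m y ∈ grN ((∑ i, dx i) + dm + (∑ j, dy j) + dg - r - s)) ∧
  (∀ (r s : ℕ) (d : ℕ → ℤ) (dm : ℤ) (a : ℕ → A) (m : M),
      (∀ q, q < r + s → a q ∈ gr (d q)) → m ∈ grM dm →
      (∑ r₁ ∈ Finset.range (r + 1), ∑ s₁ ∈ Finset.range (s + 1),
          sgn (dg * ∑ q ∈ Finset.range r₁, (d q - 1)) •
            μN r₁ s₁ (fun j => a (j : ℕ))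
              (f (r - r₁) (s - s₁) (fun j => a (r₁ + (j : ℕ))) m (fun j => a (r + (j : ℕ))))
              (fun j => a (r + (s - s₁) + (j : ℕ))))
      = (∑ r₂ ∈ Finset.Icc 1 r, ∑ i ∈ Finset.range (r + 1 - r₂),
          sgn ((∑ q ∈ Finset.range i, (d q - 1)) + dg) •
            f (r + 1 - r₂) s
              (fun j => if (j : ℕ) < i then a (j : ℕ)
                else if (j : ℕ) = i then μ r₂ (fun k => a (i + (k : ℕ)))
                else a ((j : ℕ) + r₂ - 1))
              m (fun j => a (r + (j : ℕ))))
      + (∑ r₁ ∈ Finset.range (r + 1), ∑ s₁ ∈ Finset.range (s + 1),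
          sgn ((∑ q ∈ Finset.range r₁, (d q - 1)) + dg) •
            f r₁ s₁ (fun j => a (j : ℕ))
              (μM (r - r₁) (s - s₁) (fun j => a (r₁ + (j : ℕ))) m (fun j => a (r + (j : ℕ))))
              (fun j => a (r + (s - s₁) + (j : ℕ))))
      + (∑ s₂ ∈ Finset.Icc 1 s, ∑ i ∈ Finset.range (s + 1 - s₂),
          sgn ((∑ q ∈ Finset.range (r + i), (d q - 1)) + dm + dg) •
            f r (s + 1 - s₂) (fun k => a (k : ℕ)) m
              (fun k => if (k : ℕ) < i then a (r + (k : ℕ))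
                else if (k : ℕ) = i then μ s₂ (fun t => a (r + i + (t : ℕ)))
                else a (r + (k : ℕ) + s₂ - 1))))

/-- Concatenation `(a_1,…,a_r, a₀, a_{r+1},…,a_{r+s})` of two blocks of elements
around a middle element. -/
def cat3 {A : Type} (r s : ℕ) (x : Fin r → A) (a₀ : A) (y : Fin s → A)
    (k : Fin (r + 1 + s)) : A :=
  if h : (k : ℕ) < r then x ⟨k, h⟩
  else if h2 : (k : ℕ) = r then a₀
  else y ⟨(k : ℕ) - (r + 1), by have := k.isLt; omega⟩


/-- The `n`-th summand `M ⊗ A^{⊗n}` of the Hochschild chain complex. -/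
abbrev HTens (A M : Type) [AddCommGroup A] [Module R A] [AddCommGroup M] [Module R M]
    (n : ℕ) : Type :=
  M ⊗[R] (PiTensorProduct R (fun _ : Fin n => A))

/-- The Hochschild chain module `CH_*(A;M) = ⊕ₙ M ⊗ A^{⊗n}`. -/
abbrev HChain (A M : Type) [AddCommGroup A] [Module R A] [AddCommGroup M] [Module R M] : Type :=
  DirectSum ℕ (fun n => HTens R A M n)

/-- The elementary Hochschild chain `m ⊗ a_1 ⊗ ⋯ ⊗ a_n` (the `a`'s are `a 0, …, a (n-1)`). -/
noncomputable def hchElt {A M : Type} [AddCommGroup A] [Module R A] [AddCommGroup M] [Module R M]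
    (n : ℕ) (m : M) (a : ℕ → A) : HChain R A M :=
  DirectSum.lof R ℕ (fun k => HTens R A M k) n
    (m ⊗ₜ[R] PiTensorProduct.tprod R (fun i : Fin n => a (i : ℕ)))

/-- The component `b_{i,l}` of the Hochschild differential, evaluated on the homogeneous
elementary chain `m ⊗ a_1 ⊗ ⋯ ⊗ a_n` where `m` has degree `dm` and `a_{q+1}` has degree
`d q`.  Here `i ∈ {0,…,n}` and `l ∈ {1,…,n+1}` as in the paper; the result is an
elementary chain in `M ⊗ A^{⊗(n-l+1)}` with the appropriate Koszul sign. -/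
noncomputable def bComp {A M : Type} [AddCommGroup A] [Module R A] [AddCommGroup M] [Module R M]
    (μ : (n : ℕ) → (Fin n → A) → A)
    (μM : (r s : ℕ) → (Fin r → A) → M → (Fin s → A) → M)
    (n i l : ℕ) (dm : ℤ) (d : ℕ → ℤ) (m : M) (a : ℕ → A) : HChain R A M :=
  if 1 ≤ l ∧ l ≤ n + 1 ∧ i ≤ n then
    (if i = 0 then
      DirectSum.lof R ℕ (fun k => HTens R A M k) (n + 1 - l)
        ((μM 0 (l - 1) (fun k => a (k : ℕ)) m (fun k => a (k : ℕ))) ⊗ₜ[R]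
          PiTensorProduct.tprod R (fun q : Fin (n + 1 - l) => a (l - 1 + (q : ℕ))))
    else if i + l ≤ n + 1 then
      sgn (dm + ∑ q ∈ Finset.range (i - 1), (d q - 1)) •
        DirectSum.lof R ℕ (fun k => HTens R A M k) (n + 1 - l)
          (m ⊗ₜ[R] PiTensorProduct.tprod R (fun j : Fin (n + 1 - l) =>
            if (j : ℕ) < i - 1 then a (j : ℕ)
            else if (j : ℕ) = i - 1 then μ l (fun k => a (i - 1 + (k : ℕ)))
            else a ((j : ℕ) + l - 1)))
    else
      sgn ((dm + ∑ q ∈ Finset.range (i - 1), (d q - 1)) *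
            (∑ q ∈ Finset.Ico (i - 1) n, (d q - 1))) •
        DirectSum.lof R ℕ (fun k => HTens R A M k) (n + 1 - l)
          ((μM (n - i + 1) (i + l - n - 2) (fun k => a (i - 1 + (k : ℕ))) m
              (fun k => a (k : ℕ))) ⊗ₜ[R]
            PiTensorProduct.tprod R (fun j : Fin (n + 1 - l) => a (l + i - n - 2 + (j : ℕ)))))
  else 0

/-- `b` is the Hochschild differential of `(gr,μ,grM,μM)`: on every homogeneous elementary
chain it is given by the sum of the components `b_{i,l}`. -/
def IsHochschildB {A M : Type} [AddCommGroup A] [Module R A] [AddCommGroup M] [Module R M]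
    (gr : ℤ → Submodule R A) (μ : (n : ℕ) → (Fin n → A) → A)
    (grM : ℤ → Submodule R M) (μM : (r s : ℕ) → (Fin r → A) → M → (Fin s → A) → M)
    (b : HChain R A M →ₗ[R] HChain R A M) : Prop :=
  ∀ (n : ℕ) (dm : ℤ) (d : ℕ → ℤ) (m : M) (a : ℕ → A),
    m ∈ grM dm → (∀ q, q < n → a q ∈ gr (d q)) →
    b (hchElt R n m a)
      = ∑ l ∈ Finset.Icc 1 (n + 1), ∑ i ∈ Finset.range (n + 1),
          bComp R μ μM n i l dm d m a

/-- The degree-`j` part `CH_j(A;M)` of the Hochschild chain module: the span of the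
homogeneous elementary chains `m ⊗ a_1 ⊗ ⋯ ⊗ a_n` of degree
`n − μ(m) − Σ μ(a_q) = −μ(m) − Σ ‖a_q‖ = j`. -/
noncomputable def hchDeg {A M : Type} [AddCommGroup A] [Module R A] [AddCommGroup M] [Module R M]
    (gr : ℤ → Submodule R A) (grM : ℤ → Submodule R M) (j : ℤ) :
    Submodule R (HChain R A M) :=
  Submodule.span R {x | ∃ (n : ℕ) (dm : ℤ) (d : ℕ → ℤ) (m : M) (a : ℕ → A),
    m ∈ grM dm ∧ (∀ q, q < n → a q ∈ gr (d q)) ∧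
    (-dm - ∑ q ∈ Finset.range n, (d q - 1)) = j ∧ x = hchElt R n m a}

/-- The length filtration `F_p CH_*(A;M) = ⊕_{n ≤ p} M ⊗ A^{⊗n}` (`= 0` for `p < 0`). -/
noncomputable def hchFilt {A M : Type} [AddCommGroup A] [Module R A] [AddCommGroup M] [Module R M]
    (p : ℤ) : Submodule R (HChain R A M) :=
  ⨆ (n : ℕ) (_ : (n : ℤ) ≤ p), LinearMap.range (DirectSum.lof R ℕ (fun k => HTens R A M k) n)

/-- The length filtration indexed by `ℕ∞ = ℕ ∪ {∞}`, with `F_∞ = CH_*(A;M)`. -/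
noncomputable def hchFiltE {A M : Type} [AddCommGroup A] [Module R A] [AddCommGroup M] [Module R M]
    (p : WithTop ℕ) : Submodule R (HChain R A M) :=
  ⨆ (n : ℕ) (_ : (n : WithTop ℕ) ≤ p), LinearMap.range (DirectSum.lof R ℕ (fun k => HTens R A M k) n)

/-- `b1` is the family of maps `b₁ : M ⊗ A^{⊗n} → M ⊗ A^{⊗n}` built from the
operations with exactly one input (`μ₁` and `μM_{0,0}`). -/
def IsB1 {A M : Type} [AddCommGroup A] [Module R A] [AddCommGroup M] [Module R M]
    (gr : ℤ → Submodule R A) (μ : (n : ℕ) → (Fin n → A) → A)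
    (grM : ℤ → Submodule R M) (μM : (r s : ℕ) → (Fin r → A) → M → (Fin s → A) → M)
    (b1 : (k : ℕ) → HTens R A M k →ₗ[R] HTens R A M k) : Prop :=
  ∀ (n : ℕ) (dm : ℤ) (d : ℕ → ℤ) (m : M) (a : ℕ → A),
    m ∈ grM dm → (∀ q, q < n → a q ∈ gr (d q)) →
    DirectSum.lof R ℕ (fun k => HTens R A M k) n
        (b1 n (m ⊗ₜ[R] PiTensorProduct.tprod R (fun i : Fin n => a (i : ℕ))))
      = ∑ i ∈ Finset.range (n + 1), bComp R μ μM n i 1 dm d m a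

/-- The formula for the Hochschild chain map `f_*` induced by a morphism of
`A∞`-bimodules `f = (f_{r,s}) : M → N` of degree `dg`, evaluated on a homogeneous
elementary chain. -/
noncomputable def fstarFormula {A M N : Type} [AddCommGroup A] [Module R A] [AddCommGroup M] [Module R M]
    [AddCommGroup N] [Module R N]
    (f : (r s : ℕ) → (Fin r → A) → M → (Fin s → A) → N) (dg : ℤ)
    (n : ℕ) (dm : ℤ) (d : ℕ → ℤ) (m : M) (a : ℕ → A) : HChain R A N :=
  ∑ r ∈ Finset.range (n + 1), ∑ s ∈ Finset.range (n + 1 - r),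
    sgn ((dm + ∑ q ∈ Finset.range (n - r), (d q - 1)) * (∑ q ∈ Finset.Ico (n - r) n, (d q - 1))
          + dg * (-dm - ∑ q ∈ Finset.range n, (d q - 1))) •
      DirectSum.lof R ℕ (fun k => HTens R A N k) (n - r - s)
        ((f r s (fun k => a (n - r + (k : ℕ))) m (fun k => a (k : ℕ))) ⊗ₜ[R]
          PiTensorProduct.tprod R (fun j : Fin (n - r - s) => a (s + (j : ℕ))))

/-- `F` is the Hochschild chain map induced by `f`. -/
def IsFStar {A M N : Type} [AddCommGroup A] [Module R A] [AddCommGroup M] [Module R M]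
    [AddCommGroup N] [Module R N]
    (gr : ℤ → Submodule R A) (grM : ℤ → Submodule R M)
    (f : (r s : ℕ) → (Fin r → A) → M → (Fin s → A) → N) (dg : ℤ)
    (F : HChain R A M →ₗ[R] HChain R A N) : Prop :=
  ∀ (n : ℕ) (dm : ℤ) (d : ℕ → ℤ) (m : M) (a : ℕ → A),
    m ∈ grM dm → (∀ q, q < n → a q ∈ gr (d q)) →
    F (hchElt R n m a) = fstarFormula R f dg n dm d m a


/-- The degree-`j` part of the graded dual of a graded module: those functionals which
vanish on `grV i` for every `i ≠ j`. -/
def dualGrade {V : Type} [AddCommMonoid V] [Module R V]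
    (grV : ℤ → Submodule R V) (j : ℤ) : Submodule R (Module.Dual R V) where
  carrier := {φ | ∀ i : ℤ, i ≠ j → ∀ v ∈ grV i, φ v = 0}
  add_mem' := by
    intro φ ψ hφ hψ i hi v hv
    simp [hφ i hi v hv, hψ i hi v hv]
  zero_mem' := by intro i hi v hv; simp
  smul_mem' := by
    intro c φ hφ i hi v hv
    simp [hφ i hi v hv]

/-- `μStar` is the family of structure maps of the dual `A∞`-bimodule `M^{-*}`:
tri-multilinear maps which, on homogeneous elements, are given by Tradler's formula with
the sign `(-1)^{‡_{r,s}}`.  Here a functional of degree `k` in `M^{-*}` is one that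
vanishes on `grM i` for `i ≠ -k`. -/
def IsDualOps {A M : Type} [AddCommGroup A] [Module R A] [AddCommGroup M] [Module R M]
    (gr : ℤ → Submodule R A) (grM : ℤ → Submodule R M)
    (μM : (r s : ℕ) → (Fin r → A) → M → (Fin s → A) → M)
    (μStar : (r s : ℕ) → (Fin r → A) → Module.Dual R M → (Fin s → A) → Module.Dual R M) :
    Prop :=
  (∀ r s : ℕ, IsTriMultilinear R (μStar r s)) ∧
  (∀ (r s : ℕ) (dx : Fin r → ℤ) (k : ℤ) (dy : Fin s → ℤ) (dm : ℤ)
      (x : Fin r → A) (φ : Module.Dual R M) (y : Fin s → A) (m : M),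
      (∀ i, x i ∈ gr (dx i)) → φ ∈ dualGrade R grM (-k) → (∀ j, y j ∈ gr (dy j)) →
      m ∈ grM dm →
      μStar r s x φ y m
        = sgn (((∑ i, dx i) - r) * (((∑ j, dy j) - s) + k + dm) + k + 1) •
            φ (μM s r y m x))

/-- The Hochschild cochain module `CH^*(A;P) = Πₙ Hom(A^{⊗n}, P)`, with `Hom(A^{⊗n},P)`
realized as `n`-multilinear maps. -/
abbrev HCochain (A P : Type) [AddCommGroup A] [Module R A] [AddCommGroup P] [Module R P] :
    Type :=
  (n : ℕ) → MultilinearMap R (fun _ : Fin n => A) P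

/-- The degree-`j` part `CH^j(A;P) = Πₙ Hom^{j-n}(A^{⊗n},P)` of the Hochschild cochain
module. -/
def ccDeg {A P : Type} [AddCommGroup A] [Module R A] [AddCommGroup P] [Module R P]
    (gr : ℤ → Submodule R A) (grP : ℤ → Submodule R P) (j : ℤ) :
    Submodule R (HCochain R A P) where
  carrier := {c | ∀ (n : ℕ) (dFin : Fin n → ℤ) (a : Fin n → A),
      (∀ i, a i ∈ gr (dFin i)) → c n a ∈ grP ((∑ i, dFin i) + (j - n))}
  add_mem' := by
    intro c c' hc hc' n dFin a ha
    have h : (c + c') n a = c n a + c' n a := rfl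
    rw [h]
    exact (grP _).add_mem (hc n dFin a ha) (hc' n dFin a ha)
  zero_mem' := by
    intro n dFin a ha
    have h : (0 : HCochain R A P) n a = 0 := rfl
    rw [h]
    exact (grP _).zero_mem
  smul_mem' := by
    intro t c hc n dFin a ha
    have h : (t • c) n a = t • c n a := rfl
    rw [h]
    exact (grP _).smul_mem t (hc n dFin a ha)

/-- `β` is the Hochschild codifferential on `CH^*(A;P)` for the coefficient
`A∞`-bimodule `(grP, μP)`: its value on a cochain which is homogeneous of degree `j` is
given componentwise on homogeneous elements by the defining formula. -/
def IsCodiff {A P : Type} [AddCommGroup A] [Module R A] [AddCommGroup P] [Module R P]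
    (gr : ℤ → Submodule R A) (μ : (n : ℕ) → (Fin n → A) → A)
    (grP : ℤ → Submodule R P)
    (μP : (r s : ℕ) → (Fin r → A) → P → (Fin s → A) → P)
    (β : HCochain R A P →ₗ[R] HCochain R A P) : Prop :=
  ∀ (c : HCochain R A P) (j : ℤ),
    (∀ (n : ℕ) (dFin : Fin n → ℤ) (a : Fin n → A), (∀ i, a i ∈ gr (dFin i)) →
        c n a ∈ grP ((∑ i, dFin i) + (j - n))) →
    ∀ (L : ℕ) (d : ℕ → ℤ) (a : ℕ → A), (∀ q, q < L → a q ∈ gr (d q)) →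
      β c L (fun i : Fin L => a (i : ℕ))
        = ∑ l ∈ Finset.range (L + 1),
            ((∑ i ∈ Finset.range (L - l),
                sgn (∑ q ∈ Finset.range i, (d q - 1)) •
                  c (L - l) (fun t : Fin (L - l) =>
                    if (t : ℕ) < i then a (t : ℕ)
                    else if (t : ℕ) = i then μ (l + 1) (fun k => a (i + (k : ℕ)))
                    else a ((t : ℕ) + l)))
              + ∑ i ∈ Finset.range (l + 1),
                  sgn (j * ((∑ q ∈ Finset.range i, (d q - 1)) + 1) + 1) •
                    μP i (l - i) (fun k => a (k : ℕ))
                      (c (L - l) (fun k : Fin (L - l) => a (i + (k : ℕ))))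
                      (fun k => a ((L - l) + i + (k : ℕ))))


/-- `Φ` is the duality map `φ : Hom(CH_*(A;M),R) → CH^*(A;M^{-*})`, characterized on
homogeneous elements by `(φ(g)(a_1,…,a_n))(m) = (-1)^{μ(m)·✠₁ⁿ} g(m ⊗ a_1 ⊗ ⋯ ⊗ a_n)`. -/
def IsPhi {A M : Type} [AddCommGroup A] [Module R A] [AddCommGroup M] [Module R M]
    (gr : ℤ → Submodule R A) (grM : ℤ → Submodule R M)
    (Φ : Module.Dual R (HChain R A M) →ₗ[R] HCochain R A (Module.Dual R M)) : Prop :=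
  ∀ (g : Module.Dual R (HChain R A M)) (n : ℕ) (dm : ℤ) (d : ℕ → ℤ) (m : M) (a : ℕ → A),
    m ∈ grM dm → (∀ q, q < n → a q ∈ gr (d q)) →
    Φ g n (fun i : Fin n => a (i : ℕ)) m
      = sgn (dm * ∑ q ∈ Finset.range n, (d q - 1)) • g (hchElt R n m a)

end

section Tagged

variable {A M : Type} [AddCommGroup A] [AddCommGroup M]

/-- A degree-tagged element obtained by applying `μ_l` to tagged elements. -/
def tagMu (μ : (n : ℕ) → (Fin n → A) → A) (l : ℕ) (v : Fin l → ℤ × A) : ℤ × A :=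
  ((∑ i, (v i).1) + 2 - l, μ l (fun i => (v i).2))

/-- Extension of a finite tagged tuple by zero. -/
def pad {k : ℕ} (w : Fin k → ℤ × A) : ℕ → ℤ × A :=
  fun q => if h : q < k then w ⟨q, h⟩ else (0, 0)

/-- The component `(β(f))_l` of the Hochschild codifferential with coefficients in the
`A∞`-bimodule `(M, μM)`, for a (degree-tagged) cochain `f` of arity `nf` and cochain
degree `j`, evaluated on the tagged elements `v 0, …, v (nf+l-1)`. -/
def betaT (μ : (n : ℕ) → (Fin n → A) → A)
    (μM : (r s : ℕ) → (Fin r → A) → M → (Fin s → A) → M)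
    (j : ℤ) (nf : ℕ) (f : (Fin nf → ℤ × A) → M) (l : ℕ) (v : ℕ → ℤ × A) : M :=
  (∑ i ∈ Finset.range nf,
      sgn (∑ q ∈ Finset.range i, ((v q).1 - 1)) •
        f (fun t => if (t : ℕ) < i then v (t : ℕ)
            else if (t : ℕ) = i then tagMu μ (l + 1) (fun k => v (i + (k : ℕ)))
            else v ((t : ℕ) + l)))
  + ∑ i ∈ Finset.range (l + 1),
      sgn (j * ((∑ q ∈ Finset.range i, ((v q).1 - 1)) + 1) + 1) •
        μM i (l - i) (fun k => (v (k : ℕ)).2)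
          (f (fun k => v (i + (k : ℕ))))
          (fun k => (v (nf + i + (k : ℕ))).2)

/-- The component `(β(f))_l` of the Hochschild codifferential of `CH^*(A)`, i.e. with
coefficients in `A[1]` (so `μ^{A[1]}_{i-1,l-i+1} = μ_{l+1}` and the second sign uses
`deg f − 1`), for a tagged cochain `f` of arity `nf` and `CH^*(A)`-degree `j`. -/
def betaShift (μ : (n : ℕ) → (Fin n → A) → A)
    (j : ℤ) (nf : ℕ) (f : (Fin nf → ℤ × A) → A) (l : ℕ) (v : ℕ → ℤ × A) : A :=
  (∑ i ∈ Finset.range nf,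
      sgn (∑ q ∈ Finset.range i, ((v q).1 - 1)) •
        f (fun t => if (t : ℕ) < i then v (t : ℕ)
            else if (t : ℕ) = i then tagMu μ (l + 1) (fun k => v (i + (k : ℕ)))
            else v ((t : ℕ) + l)))
  + ∑ i ∈ Finset.range (l + 1),
      sgn ((j - 1) * ((∑ q ∈ Finset.range i, ((v q).1 - 1)) + 1) + 1) •
        μ (l + 1) (fun t =>
          if (t : ℕ) < i then (v (t : ℕ)).2
          else if (t : ℕ) = i then f (fun k => v (i + (k : ℕ)))
          else (v (nf + (t : ℕ) - 1)).2)

/-- The summand `f ∪_{k,j₁,j₂} g` of the Hochschild cup product of (tagged) cochains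
`f ∈ Hom(A^{⊗m},A)` of degree `jf` and `g ∈ Hom(A^{⊗n},A)` of degree `jg`, evaluated on
the tagged elements `v 0, …, v (m+n+k-1)`, with the sign `(-1)^{℧_{j₁,j₂}}`. -/
def cupT (μ : (n : ℕ) → (Fin n → A) → A) (jf jg : ℤ) (m n : ℕ)
    (f : (Fin m → ℤ × A) → A) (g : (Fin n → ℤ × A) → A)
    (k j₁ j₂ : ℕ) (v : ℕ → ℤ × A) : A :=
  sgn ((jf - 1) * (∑ q ∈ Finset.range (j₁ - 1), ((v q).1 - 1))
       + (jg - 1) * ((∑ q ∈ Finset.range (j₂ - 1), ((v q).1 - 1)) + jf)) •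
    μ (k + 2) (fun t =>
      if (t : ℕ) < j₁ - 1 then (v (t : ℕ)).2
      else if (t : ℕ) = j₁ - 1 then f (fun k' => v (j₁ - 1 + (k' : ℕ)))
      else if (t : ℕ) < j₂ - m then (v ((t : ℕ) + m - 1)).2
      else if (t : ℕ) = j₂ - m then g (fun k' => v (j₂ - 1 + (k' : ℕ)))
      else (v ((t : ℕ) + m + n - 2)).2)

/-- The component of arity `m+n+k` of the full cup product `f ∪ g`. -/
def cupComp (μ : (n : ℕ) → (Fin n → A) → A) (jf jg : ℤ) (m n : ℕ)
    (f : (Fin m → ℤ × A) → A) (g : (Fin n → ℤ × A) → A)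
    (k : ℕ) (v : ℕ → ℤ × A) : A :=
  ∑ j₁ ∈ Finset.Icc 1 (n + k), ∑ j₂ ∈ Finset.Icc (j₁ + m) (m + k + 1),
    cupT μ jf jg m n f g k j₁ j₂ v

end Tagged

section Signs

/-- The Maltese sum `✠_i^j` of the tuple `m ⊗ a_1 ⊗ ⋯` (with `μ(m) = dm`, `μ(a_{q+1}) = d q`),
where the lower index `i ≤ 0` means that the `m`-slot is included (contributing `μ(m)`),
and the `a`-entries contribute their reduced degrees. -/
def malZ (dm : ℤ) (d : ℕ → ℤ) (i j : ℤ) : ℤ :=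
  (if i ≤ 0 then dm else 0) + ∑ q ∈ Finset.Ico (i - 1).toNat j.toNat, (d q - 1)

/-- The sign exponent `*_i = ✠_0^i · ✠_{i+1}^n` of a tuple `m ⊗ a_1 ⊗ ⋯ ⊗ a_n`. -/
def starZ (dm : ℤ) (d : ℕ → ℤ) (n : ℕ) (i : ℤ) : ℤ :=
  malZ dm d 0 i * malZ dm d (i + 1) (n : ℤ)

/-- The degree of the `M`-slot of `b_{i,l}(m ⊗ a_1 ⊗ ⋯ ⊗ a_n)`. -/
def bDm (n i l : ℕ) (dm : ℤ) (d : ℕ → ℤ) : ℤ :=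
  if i = 0 then dm + (∑ q ∈ Finset.range (l - 1), d q) + 2 - l
  else if i + l ≤ n + 1 then dm
  else dm + (∑ q ∈ Finset.Ico (i - 1) n, d q) + (∑ q ∈ Finset.range (i + l - n - 2), d q) + 2 - l

/-- The degrees of the `A`-entries of `b_{i,l}(m ⊗ a_1 ⊗ ⋯ ⊗ a_n)`. -/
def bD (n i l : ℕ) (d : ℕ → ℤ) : ℕ → ℤ := fun q =>
  if i = 0 then d (q + l - 1)
  else if i + l ≤ n + 1 then
    (if q < i - 1 then d q
     else if q = i - 1 then (∑ k ∈ Finset.range l, d (i - 1 + k)) + 2 - l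
     else d (q + l - 1))
  else d (l + i - n - 2 + q)

/-- The cup-product sign exponent `℧_{j₁,j₂}(f,g,a_1,…)` for cochains of degrees
`jf` and `jg`, computed from the degrees `e q` of the inputs `a_{q+1}`. -/
def mho (jf jg : ℤ) (j₁ j₂ : ℕ) (e : ℕ → ℤ) : ℤ :=
  (jf - 1) * (∑ q ∈ Finset.range (j₁ - 1), (e q - 1))
    + (jg - 1) * ((∑ q ∈ Finset.range (j₂ - 1), (e q - 1)) + jf)

/-- The degrees of the sequence obtained from `a_1, a_2, …` (of degrees `e 0, e 1, …`)
by replacing `a_i, …, a_{i+l}` with `μ_{l+1}(a_i,…,a_{i+l})`. -/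
def insD (e : ℕ → ℤ) (i l : ℕ) : ℕ → ℤ := fun q =>
  if q < i - 1 then e q
  else if q = i - 1 then (∑ k ∈ Finset.range (l + 1), e (i - 1 + k)) + 1 - l
  else e (q + l)

end Signs

section Auxiliary

theorem sgn_eq_negOnePow (k : ℤ) : sgn k = (k.negOnePow : ℤ) := by
  rw [sgn, ← Int.coe_negOnePow ℤ k, Int.cast_id]

theorem sgn_add (j k : ℤ) : sgn (j + k) = sgn j * sgn k := by
  simp [sgn_eq_negOnePow, Int.negOnePow_add]

theorem sgn_eq_of_even_sub {j k : ℤ} (h : Even (j - k)) : sgn j = sgn k := by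
  rw [sgn_eq_negOnePow, sgn_eq_negOnePow, (Int.negOnePow_eq_iff j k).2 h]

theorem sgn_zero : sgn 0 = 1 := by simp [sgn]

theorem sgn_smul_sgn_smul {X : Type} [AddCommGroup X] (j k : ℤ) (x : X) :
    sgn j • sgn k • x = sgn (j + k) • x := by
  rw [sgn_add, mul_smul]

/-- The sum of the reduced degrees of the first `k` entries of a degree sequence. -/
def redSum (d : ℕ → ℤ) (k : ℕ) : ℤ := ∑ q ∈ range k, (d q - 1)

theorem redSum_shift (d : ℕ → ℤ) (s k : ℕ) :
    redSum (fun q => d (s + q)) k = redSum d (s + k) - redSum d s := by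
  rw [redSum, redSum, redSum, Finset.sum_range_add, add_sub_cancel_left]

theorem sum_Ico_eq_redSum (d : ℕ → ℤ) {j k : ℕ} (h : j ≤ k) :
    ∑ q ∈ Finset.Ico j k, (d q - 1) = redSum d k - redSum d j :=
  Finset.sum_Ico_eq_sub _ h

theorem redSum_congr {d e : ℕ → ℤ} {k : ℕ} (h : ∀ q < k, d q = e q) :
    redSum d k = redSum e k :=
  Finset.sum_congr rfl fun q hq => by rw [h q (Finset.mem_range.1 hq)]

theorem sum_fin_eq_redSum_add (d : ℕ → ℤ) (k : ℕ) :
    ∑ i : Fin k, d (i : ℕ) = redSum d k + k := by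
  rw [Fin.sum_univ_eq_sum_range (fun i => d i) k, redSum]
  simp

/-- The sequence obtained from `a` by replacing the entries `p, …, p + l - 1` with their
product under `μ_l`. -/
def insertMul {A : Type} (μ : (n : ℕ) → (Fin n → A) → A) (a : ℕ → A) (p l : ℕ) : ℕ → A :=
  fun j => if j < p then a j else if j = p then μ l (fun k => a (p + (k : ℕ)))
    else a (j + l - 1)

/-- The degrees of the entries of `insertMul μ a p l`. -/
def insertDeg (d : ℕ → ℤ) (p l : ℕ) : ℕ → ℤ :=
  fun j => if j < p then d j
    else if j = p then redSum d (p + l) - redSum d p + 2 else d (j + l - 1)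

theorem redSum_insertDeg_of_le (d : ℕ → ℤ) {p l k : ℕ} (h : k ≤ p) :
    redSum (insertDeg d p l) k = redSum d k :=
  redSum_congr fun q hq => by simp [insertDeg, show q < p by omega]

theorem redSum_insertDeg_of_lt (d : ℕ → ℤ) {p l k : ℕ} (hl : 1 ≤ l) (h : p < k) :
    redSum (insertDeg d p l) k = redSum d (k + l - 1) + 1 := by
  obtain ⟨t, rfl⟩ : ∃ t, k = p + 1 + t := ⟨k - p - 1, by omega⟩
  induction t with
  | zero =>
    rw [redSum, add_zero, Finset.sum_range_succ, ← redSum, redSum_insertDeg_of_le d le_rfl,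
      show p + 1 + l - 1 = p + l by omega]
    simp only [insertDeg, lt_irrefl, if_false, if_true]
    ring
  | succ t ih =>
    rw [redSum, ← add_assoc, Finset.sum_range_succ, ← redSum, ih (by omega),
      show p + 1 + t + 1 + l - 1 = p + 1 + t + l - 1 + 1 by omega]
    simp only [insertDeg, show ¬ p + 1 + t < p by omega, show ¬ p + 1 + t = p by omega, if_false,
      redSum, Finset.sum_range_succ]
    ring

/-- Evaluation of an operation of type `(r, s)` on initial segments of two sequences. -/
def evalSeq {A M N : Type} (op : (r s : ℕ) → (Fin r → A) → M → (Fin s → A) → N)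
    (r s : ℕ) (x : ℕ → A) (m : M) (y : ℕ → A) : N :=
  op r s (fun k => x (k : ℕ)) m (fun k => y (k : ℕ))

theorem evalSeq_congr {A M N : Type} (op : (r s : ℕ) → (Fin r → A) → M → (Fin s → A) → N)
    {r r' s s' : ℕ} {x x' y y' : ℕ → A} {m m' : M} (hr : r = r') (hs : s = s')
    (hx : ∀ q < r, x q = x' q) (hm : m = m') (hy : ∀ q < s, y q = y' q) :
    evalSeq op r s x m y = evalSeq op r' s' x' m' y' := by
  subst hr hs hm
  have h₁ : (fun k : Fin r => x k) = fun k : Fin r => x' k := funext fun k => hx k k.2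
  have h₂ : (fun k : Fin s => y k) = fun k : Fin s => y' k := funext fun k => hy k k.2
  rw [evalSeq, evalSeq, h₁, h₂]

variable {R : Type} [CommRing R] {A M N : Type} [AddCommGroup A] [Module R A]
  [AddCommGroup M] [Module R M] [AddCommGroup N] [Module R N]

theorem hchElt_congr {n n' : ℕ} {m m' : M} {a a' : ℕ → A} (hn : n = n') (hm : m = m')
    (ha : ∀ q < n, a q = a' q) : hchElt R n m a = hchElt R n' m' a' := by
  subst hn hm
  have h : (fun k : Fin n => a k) = fun k : Fin n => a' k := funext fun k => ha k k.2
  rw [hchElt, hchElt, h]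

/-- The chain `m ⊗ a_1 ⊗ ⋯ ⊗ a_n` as an additive function of `m`. -/
noncomputable def hchHom (n : ℕ) (a : ℕ → A) : M →+ HChain R A M where
  toFun m := hchElt R n m a
  map_zero' := by simp [hchElt]
  map_add' x y := by simp [hchElt, TensorProduct.add_tmul]

theorem hchHom_apply (n : ℕ) (m : M) (a : ℕ → A) : hchHom n a m = hchElt R n m a := rfl

theorem multilinearMap_eq_of_homogeneous {B : Type} [AddCommGroup B] [Module R B]
    {gr : ℤ → Submodule R A} (hgr : iSup gr = ⊤) {n : ℕ}
    {g h : MultilinearMap R (fun _ : Fin n => A) B}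
    (H : ∀ (d : Fin n → ℤ) (v : Fin n → A), (∀ i, v i ∈ gr (d i)) → g v = h v) : g = h := by
  classical
  have key : ∀ (t : Finset (Fin n)) (v : Fin n → A),
      (∀ i ∉ t, ∃ e, v i ∈ gr e) → g v = h v := by
    intro t
    induction t using Finset.induction_on with
    | empty =>
      intro v hv
      choose d hd using fun i => hv i (Finset.notMem_empty i)
      exact H d v hd
    | insert i t hi ih =>
      intro v hv
      have hx : ∀ x ∈ iSup gr, g (Function.update v i x) = h (Function.update v i x) := by
        intro x hx
        induction hx using Submodule.iSup_induction' with
        | mem e x hx =>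
          refine ih _ fun j hj => ?_
          by_cases hji : j = i
          · subst hji
            exact ⟨e, by simpa using hx⟩
          · simpa [Function.update_of_ne hji] using hv j (by simp [hji, hj])
        | zero => simp
        | add x y _ _ h₁ h₂ => simp [h₁, h₂]
      simpa using hx (v i) (by rw [hgr]; trivial)
  ext v
  exact key Finset.univ v fun i hi => absurd (Finset.mem_univ i) hi

/-- Two linear maps on Hochschild chains agree if they agree on homogeneous elementary chains. -/
theorem HChain.linearMap_ext_homogeneous {B : Type} [AddCommGroup B] [Module R B]
    {gr : ℤ → Submodule R A} {grM : ℤ → Submodule R M}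
    (hgr : iSup gr = ⊤) (hgrM : iSup grM = ⊤) {g h : HChain R A M →ₗ[R] B}
    (H : ∀ (n : ℕ) (dm : ℤ) (d : ℕ → ℤ) (m : M) (a : ℕ → A), m ∈ grM dm →
      (∀ q, q < n → a q ∈ gr (d q)) → g (hchElt R n m a) = h (hchElt R n m a)) : g = h := by
  refine DirectSum.linearMap_ext R fun n => TensorProduct.ext ?_
  refine LinearMap.ext fun m => PiTensorProduct.ext ?_
  have hm : m ∈ iSup grM := by rw [hgrM]; trivial
  induction hm using Submodule.iSup_induction' with
  | zero => ext; simp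
  | add x y _ _ h₁ h₂ =>
    rw [map_add, map_add]
    ext v
    have e₁ := congrArg (fun z => z v) h₁
    have e₂ := congrArg (fun z => z v) h₂
    simp only [LinearMap.compMultilinearMap_apply, LinearMap.add_apply] at e₁ e₂ ⊢
    rw [e₁, e₂]
  | mem dm m hm =>
    refine multilinearMap_eq_of_homogeneous hgr fun d v hv => ?_
    have e := H n dm (fun q => if hq : q < n then d ⟨q, hq⟩ else 0) m
      (fun q => if hq : q < n then v ⟨q, hq⟩ else 0) hm
      (fun q hq => by simpa [hq] using hv ⟨q, hq⟩)
    simpa [hchElt] using e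

theorem evalSeq_mem {gr : ℤ → Submodule R A} {grM : ℤ → Submodule R M} {grN : ℤ → Submodule R N}
    {op : (r s : ℕ) → (Fin r → A) → M → (Fin s → A) → N} {dg : ℤ}
    (hop : ∀ (r s : ℕ) (dx : Fin r → ℤ) (dm : ℤ) (dy : Fin s → ℤ)
      (x : Fin r → A) (m : M) (y : Fin s → A),
      (∀ i, x i ∈ gr (dx i)) → m ∈ grM dm → (∀ j, y j ∈ gr (dy j)) →
      op r s x m y ∈ grN ((∑ i, dx i) + dm + (∑ j, dy j) + dg - r - s))
    {r s : ℕ} {dx dy : ℕ → ℤ} {dm : ℤ} {x y : ℕ → A} {m : M}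
    (hx : ∀ q < r, x q ∈ gr (dx q)) (hm : m ∈ grM dm) (hy : ∀ q < s, y q ∈ gr (dy q)) :
    evalSeq op r s x m y ∈ grN (dm + redSum dx r + redSum dy s + dg) := by
  have h := hop r s (fun i => dx i) dm (fun i => dy i) (fun i => x i) m (fun i => y i)
    (fun i => hx i i.2) hm (fun i => hy i i.2)
  rw [sum_fin_eq_redSum_add, sum_fin_eq_redSum_add] at h
  have e : dm + redSum dx r + redSum dy s + dg
      = redSum dx r + r + dm + (redSum dy s + s) + dg - r - s := by ring
  rw [e]
  exact h

theorem insertMul_mem {gr : ℤ → Submodule R A} {μ : (n : ℕ) → (Fin n → A) → A}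
    (hA : IsAInftyAlgebra R gr μ) {n p l : ℕ} (hl : 1 ≤ l) {d : ℕ → ℤ} {a : ℕ → A}
    (ha : ∀ q < n, a q ∈ gr (d q)) (hp : p + l ≤ n) :
    ∀ q < n + 1 - l, insertMul μ a p l q ∈ gr (insertDeg d p l q) := by
  intro q hq
  unfold insertMul insertDeg
  split_ifs with h₁ h₂
  · exact ha q (by omega)
  · have h := hA.2.1 l (fun k => d (p + k)) (fun k => a (p + k)) (fun k => ha _ (by omega))
    rw [sum_fin_eq_redSum_add (fun k => d (p + k)), redSum_shift] at h
    convert h using 2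
    ring
  · exact ha _ (by omega)

theorem sum_triangle_reindex {X : Type} [AddCommGroup X] (n : ℕ) (g : ℕ → ℕ → ℕ → ℕ → X) :
    ∑ r ∈ range (n + 1), ∑ s ∈ range (n + 1 - r), ∑ r₁ ∈ range (n - r - s + 1),
        ∑ s₁ ∈ range (n - r - s + 1 - r₁), g r s r₁ s₁
      = ∑ r ∈ range (n + 1), ∑ s ∈ range (n + 1 - r), ∑ r₁ ∈ range (r + 1),
        ∑ s₁ ∈ range (s + 1), g (r - r₁) (s - s₁) r₁ s₁ := by
  rw [sum_sigma', sum_sigma', sum_sigma', sum_sigma', sum_sigma', sum_sigma']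
  refine sum_nbij' (fun x => ⟨⟨⟨x.1.1.1 + x.1.2, x.1.1.2 + x.2⟩, x.1.2⟩, x.2⟩)
    (fun x => ⟨⟨⟨x.1.1.1 - x.1.2, x.1.1.2 - x.2⟩, x.1.2⟩, x.2⟩) ?_ ?_ ?_ ?_ ?_
  · rintro ⟨⟨⟨r, s⟩, r₁⟩, s₁⟩ h
    simp only [mem_sigma, mem_range] at h ⊢
    omega
  · rintro ⟨⟨⟨r, s⟩, r₁⟩, s₁⟩ h
    simp only [mem_sigma, mem_range] at h ⊢
    omega
  · rintro ⟨⟨⟨r, s⟩, r₁⟩, s₁⟩ h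
    simp
  · rintro ⟨⟨⟨r, s⟩, r₁⟩, s₁⟩ h
    simp only [mem_sigma, mem_range] at h
    simp only [show r - r₁ + r₁ = r by omega, show s - s₁ + s₁ = s by omega]
  · rintro ⟨⟨⟨r, s⟩, r₁⟩, s₁⟩ h
    simp

/-- Decomposition of a sum over an inner multiplication of length `l` at position `p` followed by
an operation of type `(r, s)` on the cyclic word of length `n + 1 - l`: the product lies in the
left block, in the right block, or in neither. -/
theorem sum_insert_reindex {X : Type} [AddCommGroup X] (n : ℕ) (g : ℕ → ℕ → ℕ → ℕ → X) :
    ∑ p ∈ range n, ∑ l ∈ Icc 1 (n - p), ∑ r ∈ range (n + 1 - l + 1),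
        ∑ s ∈ range (n + 1 - l + 1 - r), g p l r s
      = (∑ r ∈ range (n + 1), ∑ s ∈ range (n + 1 - r), ∑ l ∈ Icc 1 r,
          ∑ i ∈ range (r + 1 - l), g (n - r + i) l (r + 1 - l) s)
        + (∑ r ∈ range (n + 1), ∑ s ∈ range (n + 1 - r), ∑ l ∈ Icc 1 s,
          ∑ i ∈ range (s + 1 - l), g i l r (s + 1 - l))
        + ∑ r ∈ range (n + 1), ∑ s ∈ range (n + 1 - r), ∑ p ∈ range (n - r - s),
          ∑ l ∈ Icc 1 (n - r - s - p), g (s + p) l r s := by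
  rw [sum_sigma', sum_sigma', sum_sigma', sum_sigma', sum_sigma', sum_sigma', sum_sigma',
    sum_sigma', sum_sigma', sum_sigma', sum_sigma', sum_sigma',
    ← sum_filter_add_sum_filter_not _ (fun x => n + 1 - x.1.1.2 - x.1.2 ≤ x.1.1.1),
    ← sum_filter_add_sum_filter_not (filter (fun x => ¬ _) _) (fun x => x.1.1.1 < x.2),
    ← add_assoc]
  congr 1
  · congr 1
    · refine sum_nbij' (fun x => ⟨⟨⟨x.1.2 + x.1.1.2 - 1, x.2⟩, x.1.1.2⟩,
          x.1.1.1 + x.1.2 + x.1.1.2 - 1 - n⟩)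
        (fun x => ⟨⟨⟨n - x.1.1.1 + x.2, x.1.2⟩, x.1.1.1 + 1 - x.1.2⟩, x.1.1.2⟩) ?_ ?_ ?_ ?_ ?_
      · rintro ⟨⟨⟨p, l⟩, r⟩, s⟩ h
        simp only [mem_filter, mem_sigma, mem_range, mem_Icc] at h ⊢
        omega
      · rintro ⟨⟨⟨r, s⟩, l⟩, i⟩ h
        simp only [mem_filter, mem_sigma, mem_range, mem_Icc] at h ⊢
        omega
      · rintro ⟨⟨⟨p, l⟩, r⟩, s⟩ h
        simp only [mem_filter, mem_sigma, mem_range, mem_Icc] at h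
        simp only [show n - (r + l - 1) + (p + r + l - 1 - n) = p by omega,
          show r + l - 1 + 1 - l = r by omega]
      · rintro ⟨⟨⟨r, s⟩, l⟩, i⟩ h
        simp only [mem_sigma, mem_range, mem_Icc] at h
        simp only [show r + 1 - l + l - 1 = r by omega,
          show n - r + i + (r + 1 - l) + l - 1 - n = i by omega]
      · rintro ⟨⟨⟨p, l⟩, r⟩, s⟩ h
        simp only [mem_filter, mem_sigma, mem_range, mem_Icc] at h
        simp only [show n - (r + l - 1) + (p + r + l - 1 - n) = p by omega,
          show r + l - 1 + 1 - l = r by omega]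
    · refine sum_nbij' (fun x => ⟨⟨⟨x.1.2, x.2 + x.1.1.2 - 1⟩, x.1.1.2⟩, x.1.1.1⟩)
        (fun x => ⟨⟨⟨x.2, x.1.2⟩, x.1.1.1⟩, x.1.1.2 + 1 - x.1.2⟩) ?_ ?_ ?_ ?_ ?_
      · rintro ⟨⟨⟨p, l⟩, r⟩, s⟩ h
        simp only [mem_filter, mem_sigma, mem_range, mem_Icc] at h ⊢
        omega
      · rintro ⟨⟨⟨r, s⟩, l⟩, i⟩ h
        simp only [mem_filter, mem_sigma, mem_range, mem_Icc] at h ⊢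
        omega
      · rintro ⟨⟨⟨p, l⟩, r⟩, s⟩ h
        simp only [mem_filter, mem_sigma, mem_range, mem_Icc] at h
        simp only [show s + l - 1 + 1 - l = s by omega]
      · rintro ⟨⟨⟨r, s⟩, l⟩, i⟩ h
        simp only [mem_sigma, mem_range, mem_Icc] at h
        simp only [show s + 1 - l + l - 1 = s by omega]
      · rintro ⟨⟨⟨p, l⟩, r⟩, s⟩ h
        simp only [mem_filter, mem_sigma, mem_range, mem_Icc] at h
        simp only [show s + l - 1 + 1 - l = s by omega]
  · refine sum_nbij' (fun x => ⟨⟨⟨x.1.2, x.2⟩, x.1.1.1 - x.2⟩, x.1.1.2⟩)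
      (fun x => ⟨⟨⟨x.1.1.2 + x.1.2, x.2⟩, x.1.1.1⟩, x.1.1.2⟩) ?_ ?_ ?_ ?_ ?_
    · rintro ⟨⟨⟨p, l⟩, r⟩, s⟩ h
      simp only [mem_filter, mem_sigma, mem_range, mem_Icc] at h ⊢
      omega
    · rintro ⟨⟨⟨r, s⟩, p⟩, l⟩ h
      simp only [mem_filter, mem_sigma, mem_range, mem_Icc] at h ⊢
      omega
    · rintro ⟨⟨⟨p, l⟩, r⟩, s⟩ h
      simp only [mem_filter, mem_sigma, mem_range, mem_Icc] at h
      simp only [show s + (p - s) = p by omega]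
    · rintro ⟨⟨⟨r, s⟩, p⟩, l⟩ h
      simp
    · rintro ⟨⟨⟨p, l⟩, r⟩, s⟩ h
      simp only [mem_filter, mem_sigma, mem_range, mem_Icc] at h
      simp only [show s + (p - s) = p by omega]

variable {gr : ℤ → Submodule R A} {μ : (n : ℕ) → (Fin n → A) → A}
  {grM : ℤ → Submodule R M} {μM : (r s : ℕ) → (Fin r → A) → M → (Fin s → A) → M}
  {grN : ℤ → Submodule R N} {μN : (r s : ℕ) → (Fin r → A) → N → (Fin s → A) → N}

/-- The Hochschild differential, split into the terms applying the bimodule operation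
of type `(r, s)` and those applying `μ_l` to the entries starting at position `p`. -/
theorem IsHochschildB.apply_hchElt {b : HChain R A M →ₗ[R] HChain R A M}
    (hb : IsHochschildB R gr μ grM μM b) {n : ℕ} {dm : ℤ} {d : ℕ → ℤ} {m : M} {a : ℕ → A}
    (hm : m ∈ grM dm) (ha : ∀ q < n, a q ∈ gr (d q)) :
    b (hchElt R n m a)
      = (∑ r ∈ range (n + 1), ∑ s ∈ range (n + 1 - r),
          sgn ((dm + redSum d (n - r)) * (redSum d n - redSum d (n - r))) •
            hchElt R (n - r - s) (evalSeq μM r s (fun k => a (n - r + k)) m a)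
              (fun k => a (s + k)))
        + ∑ p ∈ range n, ∑ l ∈ Icc 1 (n - p),
          sgn (dm + redSum d p) • hchElt R (n + 1 - l) m (insertMul μ a p l) := by
  rw [hb n dm d m a hm ha, sum_sigma', sum_sigma', sum_sigma',
    ← sum_filter_add_sum_filter_not _ (fun x => x.2 = 0 ∨ n + 1 < x.2 + x.1)]
  congr 1
  · refine sum_nbij' (fun x => ⟨if x.2 = 0 then 0 else n + 1 - x.2,
        x.1 - 1 - (if x.2 = 0 then 0 else n + 1 - x.2)⟩)
      (fun x => ⟨x.1 + x.2 + 1, if x.1 = 0 then 0 else n + 1 - x.1⟩) ?_ ?_ ?_ ?_ ?_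
    · rintro ⟨l, i⟩ h
      simp only [mem_filter, mem_sigma, mem_range, mem_Icc] at h ⊢
      split_ifs <;> omega
    · rintro ⟨r, s⟩ h
      simp only [mem_filter, mem_sigma, mem_range, mem_Icc] at h ⊢
      split_ifs <;> omega
    · rintro ⟨l, i⟩ h
      simp only [mem_filter, mem_sigma, mem_range, mem_Icc] at h
      rcases Nat.eq_zero_or_pos i with rfl | hi
      · simp only [if_true, show 0 + (l - 1 - 0) + 1 = l by omega]
      · simp only [show i ≠ 0 by omega, show n + 1 - i ≠ 0 by omega, if_false,
          show n + 1 - i + (l - 1 - (n + 1 - i)) + 1 = l by omega,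
          show n + 1 - (n + 1 - i) = i by omega]
    · rintro ⟨r, s⟩ h
      simp only [mem_sigma, mem_range] at h
      rcases Nat.eq_zero_or_pos r with rfl | hr
      · simp
      · simp only [show r ≠ 0 by omega, show n + 1 - r ≠ 0 by omega, if_false,
          show n + 1 - (n + 1 - r) = r by omega, show r + s + 1 - 1 - r = s by omega]
    · rintro ⟨l, i⟩ h
      simp only [mem_filter, mem_sigma, mem_range, mem_Icc] at h
      dsimp only
      rw [bComp, if_pos (by omega)]
      rcases Nat.eq_zero_or_pos i with rfl | hi
      · simp only [if_true, Nat.sub_zero, sub_self, mul_zero, sgn_zero, one_smul]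
        refine (hchElt_congr (a := fun q => a (l - 1 + q)) (by omega) ?_ fun q _ => rfl)
        exact evalSeq_congr μM rfl rfl (by omega) rfl fun q _ => rfl
      · simp only [show i ≠ 0 by omega, if_false, show ¬ i + l ≤ n + 1 by omega]
        rw [sum_Ico_eq_redSum d (show i - 1 ≤ n by omega),
          show n - (n + 1 - i) = i - 1 by omega]
        congr 1
        refine (hchElt_congr (a := fun q => a (l + i - n - 2 + q)) (by omega) ?_ fun q _ => ?_)
        · exact evalSeq_congr μM (x := fun k => a (i - 1 + k)) (y := a) (by omega) (by omega)
            (fun q _ => rfl) rfl fun q _ => rfl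
        · simp only [show l - 1 - (n + 1 - i) = l + i - n - 2 by omega]
  · refine sum_nbij' (fun x => ⟨x.2 - 1, x.1⟩) (fun x => ⟨x.2, x.1 + 1⟩) ?_ ?_ ?_ ?_ ?_
    · rintro ⟨l, i⟩ h
      simp only [mem_filter, mem_sigma, mem_range, mem_Icc] at h ⊢
      omega
    · rintro ⟨p, l⟩ h
      simp only [mem_filter, mem_sigma, mem_range, mem_Icc] at h ⊢
      omega
    · rintro ⟨l, i⟩ h
      simp only [mem_filter, mem_sigma, mem_range, mem_Icc] at h
      simp only [show i - 1 + 1 = i by omega]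
    · rintro ⟨p, l⟩ h
      simp
    · rintro ⟨l, i⟩ h
      simp only [mem_filter, mem_sigma, mem_range, mem_Icc] at h
      dsimp only
      rw [bComp, if_pos (by omega), if_neg (by omega), if_pos (by omega)]
      rfl

theorem IsFStar.apply_hchElt {f : (r s : ℕ) → (Fin r → A) → M → (Fin s → A) → N} {dg : ℤ}
    {F : HChain R A M →ₗ[R] HChain R A N} (hF : IsFStar R gr grM f dg F)
    {n : ℕ} {dm : ℤ} {d : ℕ → ℤ} {m : M} {a : ℕ → A}
    (hm : m ∈ grM dm) (ha : ∀ q < n, a q ∈ gr (d q)) :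
    F (hchElt R n m a) = ∑ r ∈ range (n + 1), ∑ s ∈ range (n + 1 - r),
      sgn ((dm + redSum d (n - r)) * (redSum d n - redSum d (n - r))
          + dg * (-dm - redSum d n)) •
        hchElt R (n - r - s) (evalSeq f r s (fun k => a (n - r + k)) m a)
          (fun k => a (s + k)) := by
  rw [hF n dm d m a hm ha, fstarFormula]
  refine sum_congr rfl fun r _ => sum_congr rfl fun s _ => ?_
  rw [sum_Ico_eq_redSum d (Nat.sub_le n r)]
  rfl

/-- The sequence `a_{n-r+1}, …, a_n, a_1, a_2, …`. -/
def rotateSeq {B : Type} (n r : ℕ) (a : ℕ → B) : ℕ → B :=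
  fun q => if q < r then a (n - r + q) else a (q - r)

theorem rotateSeq_of_lt {B : Type} {n r q : ℕ} (a : ℕ → B) (h : q < r) :
    rotateSeq n r a q = a (n - r + q) := if_pos h

theorem rotateSeq_add {B : Type} (n r q : ℕ) (a : ℕ → B) :
    rotateSeq n r a (r + q) = a q := by simp [rotateSeq]

theorem redSum_rotateSeq_of_le {n r k : ℕ} (d : ℕ → ℤ) (h : k ≤ r) :
    redSum (rotateSeq n r d) k = redSum d (n - r + k) - redSum d (n - r) := by
  rw [← redSum_shift]
  exact redSum_congr fun q hq => rotateSeq_of_lt d (by omega)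

theorem redSum_rotateSeq_add {n r : ℕ} (k : ℕ) (d : ℕ → ℤ) (h : r ≤ n) :
    redSum (rotateSeq n r d) (r + k) = redSum d n - redSum d (n - r) + redSum d k := by
  have e := redSum_shift (rotateSeq n r d) r k
  simp only [rotateSeq_add] at e
  rw [redSum_rotateSeq_of_le d le_rfl, show n - r + r = n by omega] at e
  change redSum d k = _ at e
  rw [e]
  ring

/-- The defining equation of a bimodule morphism on the cyclic rotation of `m, a_1, …, a_n` which
has `r` entries to the left of `m` and `s` entries to its right. -/
theorem IsBimoduleMorphism.rotated_eq {f : (r s : ℕ) → (Fin r → A) → M → (Fin s → A) → N}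
    {dg : ℤ} (hf : IsBimoduleMorphism R gr μ grM μM grN μN dg f)
    {n r s : ℕ} {dm : ℤ} {d : ℕ → ℤ} {m : M} {a : ℕ → A} (hrs : r + s ≤ n)
    (hm : m ∈ grM dm) (ha : ∀ q < n, a q ∈ gr (d q)) :
    ∑ r₁ ∈ range (r + 1), ∑ s₁ ∈ range (s + 1),
        sgn (dg * (redSum d (n - r + r₁) - redSum d (n - r))) •
          evalSeq μN r₁ s₁ (fun k => a (n - r + k))
            (evalSeq f (r - r₁) (s - s₁) (fun k => a (n - r + r₁ + k)) m a)
            (fun k => a (s - s₁ + k))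
      = (∑ l ∈ Icc 1 r, ∑ i ∈ range (r + 1 - l),
          sgn (redSum d (n - r + i) - redSum d (n - r) + dg) •
            evalSeq f (r + 1 - l) s (fun k => insertMul μ a (n - r + i) l (n - r + k)) m a)
        + (∑ r₁ ∈ range (r + 1), ∑ s₁ ∈ range (s + 1),
          sgn (redSum d (n - r + r₁) - redSum d (n - r) + dg) •
            evalSeq f r₁ s₁ (fun k => a (n - r + k))
              (evalSeq μM (r - r₁) (s - s₁) (fun k => a (n - r + r₁ + k)) m a)
              (fun k => a (s - s₁ + k)))
        + ∑ l ∈ Icc 1 s, ∑ i ∈ range (s + 1 - l),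
          sgn (redSum d n - redSum d (n - r) + redSum d i + dm + dg) •
            evalSeq f r (s + 1 - l) (fun k => a (n - r + k)) m (insertMul μ a i l) := by
  have h := hf.2.2 r s (rotateSeq n r d) dm (rotateSeq n r a) m (fun q hq => by
    unfold rotateSeq
    split_ifs <;> exact ha _ (by omega)) hm
  refine Eq.trans ?_ (h.trans ?_)
  · refine sum_congr rfl fun r₁ hr₁ => sum_congr rfl fun s₁ hs₁ => ?_
    simp only [mem_range] at hr₁ hs₁
    rw [← redSum, redSum_rotateSeq_of_le d (by omega)]
    congr 1
    refine evalSeq_congr μN (x' := rotateSeq n r a)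
      (y' := fun k => rotateSeq n r a (r + (s - s₁) + k)) rfl rfl
      (fun q hq => (rotateSeq_of_lt a (by omega)).symm) ?_
      fun q hq => ?_
    · refine evalSeq_congr f (x' := fun k => rotateSeq n r a (r₁ + k))
        (y' := fun k => rotateSeq n r a (r + k)) rfl rfl (fun q hq => ?_) rfl
        fun q hq => (rotateSeq_add n r q a).symm
      rw [rotateSeq_of_lt a (by omega), add_assoc]
    · rw [add_assoc, rotateSeq_add]
  · congr 1
    · congr 1
      · refine sum_congr rfl fun l hl => sum_congr rfl fun i hi => ?_
        simp only [mem_range, mem_Icc] at hl hi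
        rw [← redSum, redSum_rotateSeq_of_le d (by omega)]
        congr 1
        refine evalSeq_congr f (x := insertMul μ (rotateSeq n r a) i l) rfl rfl (fun q hq => ?_)
          rfl fun q hq => rotateSeq_add n r q a
        simp only [insertMul, add_lt_add_iff_left, add_right_inj]
        split_ifs with h₁ h₂
        · rw [rotateSeq_of_lt a (by omega)]
        · congr 1
          funext k
          rw [rotateSeq_of_lt a (by omega), add_assoc]
        · rw [rotateSeq_of_lt a (by omega)]
          congr 1
          omega
      · refine sum_congr rfl fun r₁ hr₁ => sum_congr rfl fun s₁ hs₁ => ?_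
        simp only [mem_range] at hr₁ hs₁
        rw [← redSum, redSum_rotateSeq_of_le d (by omega)]
        congr 1
        refine evalSeq_congr f (x := rotateSeq n r a)
          (y := fun k => rotateSeq n r a (r + (s - s₁) + k)) rfl rfl
          (fun q hq => rotateSeq_of_lt a (by omega)) ?_ fun q hq => ?_
        · refine evalSeq_congr μM (x := fun k => rotateSeq n r a (r₁ + k))
            (y := fun k => rotateSeq n r a (r + k)) rfl rfl (fun q hq => ?_) rfl
            fun q hq => rotateSeq_add n r q a
          rw [rotateSeq_of_lt a (by omega), add_assoc]
        · rw [add_assoc, rotateSeq_add]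
    · refine sum_congr rfl fun l hl => sum_congr rfl fun i hi => ?_
      simp only [mem_range, mem_Icc] at hl hi
      rw [← redSum, redSum_rotateSeq_add i d (by omega)]
      congr 1
      refine evalSeq_congr f (y := fun k => if k < i then rotateSeq n r a (r + k)
          else if k = i then μ l (fun t => rotateSeq n r a (r + i + (t : ℕ)))
          else rotateSeq n r a (r + k + l - 1)) rfl rfl
        (fun q hq => rotateSeq_of_lt a (by omega)) rfl fun q hq => ?_
      simp only [insertMul]
      split_ifs with h₁ h₂
      · rw [rotateSeq_add]
      · simp only [add_assoc, rotateSeq_add]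
      · rw [show r + q + l - 1 = r + (q + l - 1) by omega, rotateSeq_add]

theorem IsFStar.map_mem_hchDeg {f : (r s : ℕ) → (Fin r → A) → M → (Fin s → A) → N} {dg : ℤ}
    (hf : IsBimoduleMorphism R gr μ grM μM grN μN dg f)
    {F : HChain R A M →ₗ[R] HChain R A N} (hF : IsFStar R gr grM f dg F) {j : ℤ}
    {x : HChain R A M} (hx : x ∈ hchDeg R gr grM j) : F x ∈ hchDeg R gr grN (j - dg) := by
  induction hx using Submodule.span_induction with
  | zero => simp
  | add x y _ _ h₁ h₂ => simpa using Submodule.add_mem _ h₁ h₂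
  | smul c x _ h => simpa using Submodule.smul_mem _ c h
  | mem x hx =>
    obtain ⟨n, dm, d, m, a, hm, ha, rfl, rfl⟩ := hx
    rw [hF.apply_hchElt hm ha]
    refine Submodule.sum_mem _ fun r hr => Submodule.sum_mem _ fun s hs => ?_
    simp only [mem_range] at hr hs
    refine zsmul_mem ?_ _
    refine Submodule.subset_span ⟨n - r - s, _, fun q => d (s + q), _, _,
      evalSeq_mem hf.2.1 (dx := fun q => d (n - r + q)) (dy := d)
        (fun q hq => ha _ (by omega)) hm fun q hq => ha _ (by omega),
      fun q hq => ha _ (by omega), ?_, rfl⟩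
    rw [← redSum, ← redSum, redSum_shift, redSum_shift, show n - r + r = n by omega,
      show s + (n - r - s) = n - r by omega]
    ring

/-- The sign exponent of the component of type `(r, s)` of the map induced by a bimodule morphism
of degree `dg`. -/
def inducedSign (dg : ℤ) (n : ℕ) (dm : ℤ) (d : ℕ → ℤ) (r : ℕ) : ℤ :=
  (dm + redSum d (n - r)) * (redSum d n - redSum d (n - r)) + dg * (-dm - redSum d n)

/-- The terms of `b ∘ f_*` in which the multiplication and the morphism `f` have disjoint inputs. -/
noncomputable def disjointTerms (R : Type) [CommRing R] [Module R A] [Module R N]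
    (μ : (n : ℕ) → (Fin n → A) → A) (f : (r s : ℕ) → (Fin r → A) → M → (Fin s → A) → N)
    (dg : ℤ) (n : ℕ) (dm : ℤ) (d : ℕ → ℤ) (m : M) (a : ℕ → A) : HChain R A N :=
  ∑ r ∈ range (n + 1), ∑ s ∈ range (n + 1 - r),
    ∑ p ∈ range (n - r - s), ∑ l ∈ Icc 1 (n - r - s - p),
      sgn (inducedSign dg n dm d r + dm + dg + redSum d n - redSum d (n - r) + redSum d (s + p)) •
        hchElt R (n - r - s + 1 - l) (evalSeq f r s (fun k => a (n - r + k)) m a)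
          (insertMul μ (fun k => a (s + k)) p l)

section ChainMap

variable {f : (r s : ℕ) → (Fin r → A) → M → (Fin s → A) → N} {dg : ℤ}
  {F : HChain R A M →ₗ[R] HChain R A N} {n : ℕ} {dm : ℤ} {d : ℕ → ℤ} {m : M} {a : ℕ → A}

theorem IsFStar.hochschildB_apply (hf : IsBimoduleMorphism R gr μ grM μM grN μN dg f)
    {bN : HChain R A N →ₗ[R] HChain R A N} (hbN : IsHochschildB R gr μ grN μN bN)
    (hF : IsFStar R gr grM f dg F) (hm : m ∈ grM dm) (ha : ∀ q < n, a q ∈ gr (d q)) :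
    bN (F (hchElt R n m a)) =
      (∑ r ∈ range (n + 1), ∑ s ∈ range (n + 1 - r), sgn (inducedSign dg n dm d r) •
        hchHom (n - r - s) (fun k => a (s + k))
        (∑ r₁ ∈ range (r + 1), ∑ s₁ ∈ range (s + 1),
          sgn (dg * (redSum d (n - r + r₁) - redSum d (n - r))) •
            evalSeq μN r₁ s₁ (fun k => a (n - r + k))
              (evalSeq f (r - r₁) (s - s₁) (fun k => a (n - r + r₁ + k)) m a)
              (fun k => a (s - s₁ + k)))) + disjointTerms R μ f dg n dm d m a := by
  have h₁ : bN (F (hchElt R n m a)) = ∑ r ∈ range (n + 1), ∑ s ∈ range (n + 1 - r),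
      sgn (inducedSign dg n dm d r) •
        bN (hchElt R (n - r - s) (evalSeq f r s (fun k => a (n - r + k)) m a)
          (fun k => a (s + k))) := by
    rw [hF.apply_hchElt hm ha]
    simp only [map_sum, map_zsmul]
    rfl
  rw [h₁]
  have h₂ : ∀ r ∈ range (n + 1), ∀ s ∈ range (n + 1 - r),
      bN (hchElt R (n - r - s) (evalSeq f r s (fun k => a (n - r + k)) m a)
        (fun k => a (s + k))) = _ := fun r hr s hs => by
    simp only [mem_range] at hr hs
    exact hbN.apply_hchElt (d := fun q => d (s + q))
      (evalSeq_mem hf.2.1 (dx := fun q => d (n - r + q)) (dy := d)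
        (fun q hq => ha _ (by omega)) hm fun q hq => ha _ (by omega))
      (fun q hq => ha _ (by omega))
  refine (sum_congr rfl fun r hr => sum_congr rfl fun s hs =>
    congrArg (sgn _ • ·) (h₂ r hr s hs)).trans ?_
  simp only [smul_add, smul_sum, sum_add_distrib, sgn_smul_sgn_smul, map_sum, map_zsmul,
    hchHom_apply]
  refine congrArg₂ (· + ·) ?_ ?_
  · rw [sum_triangle_reindex]
    refine sum_congr rfl fun r hr => sum_congr rfl fun s hs => sum_congr rfl fun r₁ hr₁ =>
      sum_congr rfl fun s₁ hs₁ => ?_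
    simp only [mem_range] at hr hs hr₁ hs₁
    simp only [redSum_shift, inducedSign]
    simp only [show n - (r - r₁) = n - r + r₁ by omega,
      show n - r + r₁ + (r - r₁) = n by omega,
      show s - s₁ + (n - r + r₁ - (s - s₁)) = n - r + r₁ by omega,
      show s - s₁ + (n - r + r₁ - (s - s₁) - r₁) = n - r by omega]
    refine congrArg₂ _ (sgn_eq_of_even_sub ?_) (hchElt_congr (by omega) ?_ fun q hq => ?_)
    · simp only [parity_simps]
      grind
    · refine evalSeq_congr μN rfl rfl (fun q hq => ?_) rfl fun q hq => rfl
      congr 1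
      omega
    · congr 1
      omega
  · refine sum_congr rfl fun r hr => sum_congr rfl fun s hs => sum_congr rfl fun p hp =>
      sum_congr rfl fun l hl => ?_
    simp only [mem_range] at hr hs
    simp only [redSum_shift, show n - r + r = n by omega]
    refine congrArg₂ _ (congrArg sgn ?_) rfl
    ring

theorem IsFStar.apply_bimodule_terms (hM : IsAInftyBimodule R gr μ grM μM)
    (hF : IsFStar R gr grM f dg F) (hm : m ∈ grM dm) (ha : ∀ q < n, a q ∈ gr (d q)) :
    F (∑ r ∈ range (n + 1), ∑ s ∈ range (n + 1 - r),
        sgn ((dm + redSum d (n - r)) * (redSum d n - redSum d (n - r))) •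
          hchElt R (n - r - s) (evalSeq μM r s (fun k => a (n - r + k)) m a)
            (fun k => a (s + k)))
      = ∑ r ∈ range (n + 1), ∑ s ∈ range (n + 1 - r), sgn (inducedSign dg n dm d r) •
        hchHom (n - r - s) (fun k => a (s + k))
        (∑ r₁ ∈ range (r + 1), ∑ s₁ ∈ range (s + 1),
          sgn (redSum d (n - r + r₁) - redSum d (n - r) + dg) •
            evalSeq f r₁ s₁ (fun k => a (n - r + k))
              (evalSeq μM (r - r₁) (s - s₁) (fun k => a (n - r + r₁ + k)) m a)
              (fun k => a (s - s₁ + k))) := by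
  simp only [map_sum, map_zsmul]
  have h₁ : ∀ r ∈ range (n + 1), ∀ s ∈ range (n + 1 - r),
      F (hchElt R (n - r - s) (evalSeq μM r s (fun k => a (n - r + k)) m a)
        (fun k => a (s + k))) = _ := fun r hr s hs => by
    simp only [mem_range] at hr hs
    exact hF.apply_hchElt (d := fun q => d (s + q))
      (evalSeq_mem hM.2.1 (dx := fun q => d (n - r + q)) (dy := d)
        (fun q hq => ha _ (by omega)) hm fun q hq => ha _ (by omega))
      (fun q hq => ha _ (by omega))
  refine (sum_congr rfl fun r hr => sum_congr rfl fun s hs =>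
    congrArg (sgn _ • ·) (h₁ r hr s hs)).trans ?_
  simp only [smul_sum, sgn_smul_sgn_smul, hchHom_apply]
  rw [sum_triangle_reindex]
  refine sum_congr rfl fun r hr => sum_congr rfl fun s hs => sum_congr rfl fun r₁ hr₁ =>
    sum_congr rfl fun s₁ hs₁ => ?_
  simp only [mem_range] at hr hs hr₁ hs₁
  simp only [redSum_shift, inducedSign]
  simp only [show n - (r - r₁) = n - r + r₁ by omega,
    show n - r + r₁ + (r - r₁) = n by omega,
    show s - s₁ + (n - r + r₁ - (s - s₁)) = n - r + r₁ by omega,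
    show s - s₁ + (n - r + r₁ - (s - s₁) - r₁) = n - r by omega]
  refine congrArg₂ _ (sgn_eq_of_even_sub ?_) (hchElt_congr (by omega) ?_ fun q hq => ?_)
  · simp only [parity_simps, Int.not_even_one]
    grind
  · refine evalSeq_congr f rfl rfl (fun q hq => ?_) rfl fun q hq => rfl
    congr 1
    omega
  · congr 1
    omega

theorem IsFStar.apply_multiplication_terms (hA : IsAInftyAlgebra R gr μ)
    (hF : IsFStar R gr grM f dg F) (hm : m ∈ grM dm) (ha : ∀ q < n, a q ∈ gr (d q)) :
    F (∑ p ∈ range n, ∑ l ∈ Icc 1 (n - p),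
        sgn (dm + redSum d p) • hchElt R (n + 1 - l) m (insertMul μ a p l))
      = (∑ r ∈ range (n + 1), ∑ s ∈ range (n + 1 - r), sgn (inducedSign dg n dm d r) •
        hchHom (n - r - s) (fun k => a (s + k))
        (∑ l ∈ Icc 1 r, ∑ i ∈ range (r + 1 - l),
          sgn (redSum d (n - r + i) - redSum d (n - r) + dg) •
            evalSeq f (r + 1 - l) s (fun k => insertMul μ a (n - r + i) l (n - r + k)) m a))
      + (∑ r ∈ range (n + 1), ∑ s ∈ range (n + 1 - r), sgn (inducedSign dg n dm d r) •
        hchHom (n - r - s) (fun k => a (s + k))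
        (∑ l ∈ Icc 1 s, ∑ i ∈ range (s + 1 - l),
          sgn (redSum d n - redSum d (n - r) + redSum d i + dm + dg) •
            evalSeq f r (s + 1 - l) (fun k => a (n - r + k)) m (insertMul μ a i l)))
      + disjointTerms R μ f dg n dm d m a := by
  simp only [map_sum, map_zsmul]
  have h₂ : ∀ p ∈ range n, ∀ l ∈ Icc 1 (n - p),
      F (hchElt R (n + 1 - l) m (insertMul μ a p l)) = _ := fun p hp l hl => by
    simp only [mem_range, mem_Icc] at hp hl
    exact hF.apply_hchElt hm (insertMul_mem hA hl.1 ha (by omega))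
  refine (sum_congr rfl fun p hp => sum_congr rfl fun l hl =>
    congrArg (sgn _ • ·) (h₂ p hp l hl)).trans ?_
  simp only [smul_sum, sgn_smul_sgn_smul, hchHom_apply]
  rw [sum_insert_reindex]
  refine congrArg₂ (· + ·) (congrArg₂ (· + ·) ?_ ?_) ?_
  · refine sum_congr rfl fun r hr => sum_congr rfl fun s hs => sum_congr rfl fun l hl =>
      sum_congr rfl fun i hi => ?_
    simp only [mem_range, mem_Icc] at hr hs hl hi
    simp only [show n + 1 - l - (r + 1 - l) = n - r by omega]
    rw [redSum_insertDeg_of_lt (k := n + 1 - l) d hl.1 (by omega),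
      redSum_insertDeg_of_le (k := n - r) d (by omega),
      show n + 1 - l + l - 1 = n by omega]
    refine congrArg₂ _ (sgn_eq_of_even_sub ?_) (hchElt_congr (by omega) ?_ fun q hq => ?_)
    · simp only [inducedSign, parity_simps, Int.not_even_one]
      grind
    · refine evalSeq_congr f rfl rfl (fun q hq => rfl) rfl fun q hq => ?_
      exact if_pos (by omega)
    · exact if_pos (by omega)
  · refine sum_congr rfl fun r hr => sum_congr rfl fun s hs => sum_congr rfl fun l hl =>
      sum_congr rfl fun i hi => ?_
    simp only [mem_range, mem_Icc] at hr hs hl hi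
    rw [redSum_insertDeg_of_lt d hl.1 (by omega), redSum_insertDeg_of_lt d hl.1 (by omega),
      show n + 1 - l + l - 1 = n by omega, show n + 1 - l - r + l - 1 = n - r by omega]
    refine congrArg₂ _ (sgn_eq_of_even_sub ?_) (hchElt_congr (by omega) ?_ fun q hq => ?_)
    · simp only [inducedSign, parity_simps, Int.not_even_one]
      grind
    · refine evalSeq_congr f rfl rfl (fun q hq => ?_) rfl fun q hq => rfl
      simp only [insertMul, show ¬ n + 1 - l - r + q < i by omega,
        show ¬ n + 1 - l - r + q = i by omega, if_false]
      congr 1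
      omega
    · simp only [insertMul, show ¬ s + 1 - l + q < i by omega,
        show ¬ s + 1 - l + q = i by omega, if_false]
      congr 1
      omega
  · refine sum_congr rfl fun r hr => sum_congr rfl fun s hs => sum_congr rfl fun p hp =>
      sum_congr rfl fun l hl => ?_
    simp only [mem_range, mem_Icc] at hr hs hl hp
    rw [redSum_insertDeg_of_lt d hl.1 (by omega), redSum_insertDeg_of_lt d hl.1 (by omega),
      show n + 1 - l + l - 1 = n by omega, show n + 1 - l - r + l - 1 = n - r by omega]
    refine congrArg₂ _ (sgn_eq_of_even_sub ?_) (hchElt_congr (by omega) ?_ fun q hq => ?_)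
    · simp only [inducedSign, parity_simps, Int.not_even_one]
      grind
    · refine evalSeq_congr f rfl rfl (fun q hq => ?_) rfl fun q hq => ?_
      · simp only [insertMul, show ¬ n + 1 - l - r + q < s + p by omega,
          show ¬ n + 1 - l - r + q = s + p by omega, if_false]
        congr 1
        omega
      · exact if_pos (by omega)
    · simp only [insertMul, add_lt_add_iff_left, add_right_inj, add_assoc]
      split_ifs
      · rfl
      · rfl
      · congr 1
        omega

theorem IsFStar.hochschildB_comm_hchElt
    (hA : IsAInftyAlgebra R gr μ) (hM : IsAInftyBimodule R gr μ grM μM)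
    (hf : IsBimoduleMorphism R gr μ grM μM grN μN dg f)
    {bM : HChain R A M →ₗ[R] HChain R A M} (hbM : IsHochschildB R gr μ grM μM bM)
    {bN : HChain R A N →ₗ[R] HChain R A N} (hbN : IsHochschildB R gr μ grN μN bN)
    (hF : IsFStar R gr grM f dg F) (hm : m ∈ grM dm) (ha : ∀ q < n, a q ∈ gr (d q)) :
    bN (F (hchElt R n m a)) = F (bM (hchElt R n m a)) := by
  rw [hbM.apply_hchElt hm ha, map_add, hF.apply_bimodule_terms hM hm ha,
    hF.apply_multiplication_terms hA hm ha, hF.hochschildB_apply hf hbN hm ha, ← add_assoc,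
    ← add_assoc, add_comm (∑ r ∈ range (n + 1), ∑ s ∈ range (n + 1 - r), _ • hchHom _ _
      (∑ r₁ ∈ range (r + 1), ∑ s₁ ∈ range (s + 1), sgn (_ + dg) • _))]
  simp only [← sum_add_distrib, ← smul_add, ← map_add]
  refine congrArg₂ (· + ·) (sum_congr rfl fun r hr => sum_congr rfl fun s hs => ?_) rfl
  simp only [mem_range] at hr hs
  rw [hf.rotated_eq (by omega) hm ha]

end ChainMap

end Auxiliary

section

variable (R : Type) [CommRing R]

/-- Theorem 2.8 of the paper.  Let `A` be an `A∞`-algebra over `R`,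
`M`, `N` `A∞`-bimodules over `A` and `f = (f_{r,s})` a morphism of `A∞`-bimodules of
degree `dg`.  Then the induced map `f_* : CH_*(A;M) → CH_*(A;N)` (given on homogeneous
elementary chains by `Σ (-1)^{†_r} f̄_{r,s}`) is a chain map of degree `-dg`:
it maps `CH_j(A;M)` into `CH_{j-dg}(A;N)` and satisfies `b ∘ f_* = f_* ∘ b`. -/
theorem induced_hochschild_chain_map
    {A M N : Type} [AddCommGroup A] [Module R A] [AddCommGroup M] [Module R M]
    [AddCommGroup N] [Module R N]
    (gr : ℤ → Submodule R A) (μ : (n : ℕ) → (Fin n → A) → A)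
    (grM : ℤ → Submodule R M) (μM : (r s : ℕ) → (Fin r → A) → M → (Fin s → A) → M)
    (grN : ℤ → Submodule R N) (μN : (r s : ℕ) → (Fin r → A) → N → (Fin s → A) → N)
    (hA : IsAInftyAlgebra R gr μ)
    (hM : IsAInftyBimodule R gr μ grM μM) (hN : IsAInftyBimodule R gr μ grN μN)
    (hgr : DirectSum.IsInternal gr) (hgrM : DirectSum.IsInternal grM)
    (hgrN : DirectSum.IsInternal grN)
    (dg : ℤ) (f : (r s : ℕ) → (Fin r → A) → M → (Fin s → A) → N)
    (hf : IsBimoduleMorphism R gr μ grM μM grN μN dg f)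
    (bM : HChain R A M →ₗ[R] HChain R A M) (hbM : IsHochschildB R gr μ grM μM bM)
    (bN : HChain R A N →ₗ[R] HChain R A N) (hbN : IsHochschildB R gr μ grN μN bN)
    (F : HChain R A M →ₗ[R] HChain R A N)
    (hF : IsFStar R gr grM f dg F) :
    (∀ (j : ℤ) (x : HChain R A M), x ∈ hchDeg R gr grM j → F x ∈ hchDeg R gr grN (j - dg)) ∧
    (∀ x : HChain R A M, bN (F x) = F (bM x)) := by
  refine ⟨fun j x hx => hF.map_mem_hchDeg hf hx, LinearMap.congr_fun (f := bN ∘ₗ F) (g := F ∘ₗ bM)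
    (HChain.linearMap_ext_homogeneous hgr.submodule_iSup_eq_top hgrM.submodule_iSup_eq_top
      fun _ _ _ _ _ hm ha => hF.hochschildB_comm_hchElt hA hM hf hbM hbN hm ha)⟩

end

end AInfPaper
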